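/- Let T = ℝ[[x, y, z, w]]/(x² − yz) and let Q be the image in T of the ideal (x, y, z). Then T is a (complete local Noetherian) integral domain, Q is a nonmaximal prime ideal of T, x is a nonzero element of Q, every associated prime P of the T-module T/xT satisfies P ⊆ Q, (Q \ xT)Π[x] ∩ Π[x] = {0} where Π[x] is the smallest subring of T containing the image of x, and P ∩ Π[x] = (0) for every associated prime P of T. Consequently, there exists a local (Noetherian quasilocal) domain A ⊆ T containing the image of x such that the inclusion A ⊆ T induces an isomorphism of the adic completion of A at its maximal ideal with T, xA is a prime ideal of A, Q ∩ A = xA, and every prime ideal Q' of T with Q' ∩ A = xA satisfies Q' ⊆ Q. -/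

import Mathlib

noncomputable section

/-- The set `(Q \ pT)R = {t ∈ T | t = qr for some q ∈ Q \ pT, r ∈ R}`. -/
def CompAvoid {T : Type} [CommRing T] (Q : Ideal T) (p : T) (R : Set T) : Set T :=
  {t : T | ∃ q ∈ Q, q ∉ Ideal.span {p} ∧ ∃ r ∈ R, t = q * r}

/-- The formal power series ring `ℝ[[x, y, z, w]]`. -/
abbrev PSex : Type := MvPowerSeries (Fin 4) ℝ

/-- The ideal `(x² - yz)` of `ℝ[[x, y, z, w]]`. -/
def relIex : Ideal PSex :=
  Ideal.span {(MvPowerSeries.X 0 : PSex) ^ 2 - MvPowerSeries.X 1 * MvPowerSeries.X 2}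

/-- The ring `T = ℝ[[x, y, z, w]]/(x² - yz)`. -/
abbrev Tex : Type := PSex ⧸ relIex

/-- The image `x` of the variable `x` in `T`. -/
def xbar : Tex := Ideal.Quotient.mk relIex (MvPowerSeries.X 0)

/-- The image `Q` in `T` of the ideal `(x, y, z)`. -/
def Qex : Ideal Tex :=
  (Ideal.span {(MvPowerSeries.X 0 : PSex), MvPowerSeries.X 1, MvPowerSeries.X 2}).map
    (Ideal.Quotient.mk relIex)

/-- A subring `A` of `T` whose elements in the prime ideal `Q` are the multiples of `x`, which is
saturated with respect to division by elements outside `Q`, and which meets every coset of every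
ideal not contained in `Q` in an element outside `Q`. -/
structure IsFiberSubring {T : Type*} [CommRing T] (Q : Ideal T) (x : T) (A : Subring T) :
    Prop where
  mem : x ∈ A
  exists_eq_mul : ∀ a ∈ A, a ∈ Q → ∃ b ∈ A, a = x * b
  saturated : ∀ t, ∀ h ∈ A, h ∉ Q → h * t ∈ A → t ∈ A
  exists_dvd_sub : ∀ t h, h ∉ Q → ∃ a ∈ A, a ∉ Q ∧ h ∣ a - t

namespace IsFiberSubring

variable {T : Type*} [CommRing T] {Q : Ideal T} {x : T} {A : Subring T}

theorem comap_eq_span (hA : IsFiberSubring Q x A) (hxQ : x ∈ Q) :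
    Q.comap A.subtype = Ideal.span {(⟨x, hA.mem⟩ : A)} := by
  ext a
  rw [Ideal.mem_comap, Ideal.mem_span_singleton']
  constructor
  · intro ha
    obtain ⟨b, hb, hab⟩ := hA.exists_eq_mul a a.2 ha
    exact ⟨⟨b, hb⟩, Subtype.ext (by simp [hab, mul_comm])⟩
  · rintro ⟨b, rfl⟩
    exact Q.mul_mem_left _ hxQ

theorem le_of_comap_eq (hA : IsFiberSubring Q x A) (hxQ : x ∈ Q) {J : Ideal T}
    (hJ : J.comap A.subtype = Ideal.span {(⟨x, hA.mem⟩ : A)}) : J ≤ Q := by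
  rw [← hA.comap_eq_span hxQ] at hJ
  by_contra h
  obtain ⟨j, hj, hjQ⟩ := SetLike.not_le_iff_exists.mp h
  obtain ⟨a, ha, haQ, c, hc⟩ := hA.exists_dvd_sub 0 j hjQ
  have : (⟨a, ha⟩ : A) ∈ J.comap A.subtype := by
    rw [sub_zero] at hc
    exact Ideal.mem_comap.2 (hc ▸ J.mul_mem_right c hj :)
  rw [hJ] at this
  exact haQ this

theorem isLocalHom [Q.IsPrime] (hA : IsFiberSubring Q x A) : IsLocalHom A.subtype where
  map_nonunit a ha := by
    obtain ⟨b, hb⟩ := ha.exists_right_inv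
    have haQ : (a : T) ∉ Q := fun h ↦ Ideal.IsPrime.ne_top ‹_› (Q.eq_top_of_isUnit_mem h ha)
    exact .of_mul_eq_one (⟨b, hA.saturated b a a.2 haQ (by simpa using hb ▸ A.one_mem)⟩ : A)
      (Subtype.ext hb)

theorem quotient_mk_comp_surjective (hA : IsFiberSubring Q x A) {J : Ideal T} {h : T}
    (hJ : h ∈ J) (hQ : h ∉ Q) :
    Function.Surjective ((Ideal.Quotient.mk J).comp A.subtype) := by
  intro t
  obtain ⟨t, rfl⟩ := Ideal.Quotient.mk_surjective t
  obtain ⟨a, ha, -, hd⟩ := hA.exists_dvd_sub t h hQ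
  exact ⟨⟨a, ha⟩, Ideal.Quotient.eq.2 (J.mem_of_dvd hd hJ)⟩

theorem ker_quotient_mk_comp (hA : IsFiberSubring Q x A) {h : A} (hQ : (h : T) ∉ Q) :
    RingHom.ker ((Ideal.Quotient.mk (Ideal.span {(h : T)})).comp A.subtype) =
      Ideal.span {h} := by
  ext a
  rw [RingHom.mem_ker, RingHom.comp_apply, Ideal.Quotient.eq_zero_iff_mem,
    Ideal.mem_span_singleton, Ideal.mem_span_singleton]
  constructor
  · rintro ⟨c, hc⟩
    rw [Subring.coe_subtype] at hc
    exact ⟨⟨c, hA.saturated c h h.2 hQ (hc ▸ a.2)⟩, Subtype.ext hc⟩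
  · exact fun hd ↦ map_dvd A.subtype hd

theorem comap_map_quotient_mk_comp (hA : IsFiberSubring Q x A) {I J : Ideal A} {h : A}
    (hQ : (h : T) ∉ Q) (hJ : J ⊔ Ideal.span {h} = I) :
    (J.map ((Ideal.Quotient.mk (Ideal.span {(h : T)})).comp A.subtype)).comap
      ((Ideal.Quotient.mk (Ideal.span {(h : T)})).comp A.subtype) = I := by
  rw [Ideal.comap_map_of_surjective' _
    (hA.quotient_mk_comp_surjective (Ideal.mem_span_singleton_self _) hQ),
    hA.ker_quotient_mk_comp hQ, hJ]

theorem comap_map_eq (hA : IsFiberSubring Q x A) {I : Ideal A} {h : A} (hI : h ∈ I)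
    (hQ : (h : T) ∉ Q) : (I.map A.subtype).comap A.subtype = I := by
  refine le_antisymm ?_ Ideal.le_comap_map
  conv_rhs => rw [← hA.comap_map_quotient_mk_comp hQ (J := I)
    (sup_eq_left.2 ((Ideal.span_singleton_le_iff_mem _).2 hI))]
  rw [← Ideal.map_map, ← Ideal.comap_comap]
  exact Ideal.comap_mono Ideal.le_comap_map

theorem fg_of_mem [IsNoetherianRing T] (hA : IsFiberSubring Q x A) {I : Ideal A} {h : A}
    (hI : h ∈ I) (hQ : (h : T) ∉ Q) : I.FG := by
  classical
  set g := (Ideal.Quotient.mk (Ideal.span {(h : T)})).comp A.subtype with hg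
  have hfg : (Ideal.span (g '' I)).FG := (isNoetherianRing_iff_ideal_fg _).1 inferInstance _
  obtain ⟨s, hs, hsI⟩ := (Submodule.fg_span_iff_fg_span_finset_subset _).1 hfg
  obtain ⟨u, hu, rfl⟩ := Finset.subset_set_image_iff.1 hs
  have hle : Ideal.span (u : Set A) ⊔ Ideal.span {h} ≤ I :=
    sup_le (Ideal.span_le.2 hu) ((Ideal.span_singleton_le_iff_mem _).2 hI)
  have hmap : I.map g = (Ideal.span (u : Set A)).map g := by
    rw [Ideal.map_span, ← Finset.coe_image]
    exact hsI
  have key : Ideal.span (u : Set A) ⊔ Ideal.span {h} = I := by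
    refine le_antisymm hle ?_
    rw [← hA.comap_map_quotient_mk_comp (J := Ideal.span (u : Set A)) hQ rfl, ← hg, ← hmap]
    exact Ideal.le_comap_map
  rw [← key]
  exact Submodule.FG.sup ⟨u, rfl⟩ ⟨{h}, by simp⟩

theorem isNoetherianRing [IsDomain T] [IsNoetherianRing T] [Q.IsPrime]
    (hA : IsFiberSubring Q x A) (hxQ : x ∈ Q) : IsNoetherianRing A := by
  refine .of_prime fun P hP ↦ ?_
  by_cases h : P ≤ Q.comap A.subtype
  · rw [hA.comap_eq_span hxQ] at h
    by_cases hx : (⟨x, hA.mem⟩ : A) ∈ P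
    · rw [le_antisymm h ((Ideal.span_singleton_le_iff_mem _).2 hx)]
      exact ⟨{⟨x, hA.mem⟩}, by simp⟩
    · have hdiv : ∀ n : ℕ, ∀ a ∈ P, ∃ b ∈ P, a = (⟨x, hA.mem⟩ : A) ^ n * b := by
        intro n
        induction n with
        | zero => exact fun a ha ↦ ⟨a, ha, by simp⟩
        | succ n ih =>
          intro a ha
          obtain ⟨b, hb, rfl⟩ := ih a ha
          obtain ⟨c, rfl⟩ := Ideal.mem_span_singleton.1 (h hb)
          exact ⟨c, (hP.mem_or_mem hb).resolve_left hx, by ring⟩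
      have hbot : P = ⊥ := by
        rw [eq_bot_iff]
        intro a ha
        have hinf : (a : T) ∈ ⨅ n : ℕ, Ideal.span {x} ^ n := by
          rw [Ideal.mem_iInf]
          intro n
          obtain ⟨b, -, rfl⟩ := hdiv n a ha
          rw [Ideal.span_singleton_pow, Ideal.mem_span_singleton]
          exact ⟨b, rfl⟩
        rw [Ideal.iInf_pow_eq_bot_of_isDomain] at hinf
        · exact Subtype.ext hinf
        · exact fun htop ↦ Ideal.IsPrime.ne_top ‹Q.IsPrime› (top_le_iff.1
            (htop ▸ (Ideal.span_singleton_le_iff_mem _).2 hxQ))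
      exact hbot ▸ Submodule.fg_bot
  · obtain ⟨a, ha, haQ⟩ := SetLike.not_le_iff_exists.mp h
    exact hA.fg_of_mem ha haQ

open IsLocalRing

variable [IsLocalRing T] [IsLocalRing A] [Q.IsPrime]

theorem comap_maximalIdeal (hA : IsFiberSubring Q x A) :
    (maximalIdeal T).comap A.subtype = maximalIdeal A :=
  have := hA.isLocalHom
  maximalIdeal_comap _

theorem exists_mem_maximalIdeal (hA : IsFiberSubring Q x A) (hQ : ¬ Q.IsMaximal) :
    ∃ a ∈ maximalIdeal A, (a : T) ∉ Q := by
  have hlt : ¬ maximalIdeal T ≤ Q := fun h ↦ hQ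
    ((maximalIdeal.isMaximal T).eq_of_le (Ideal.IsPrime.ne_top ‹_›) h ▸ maximalIdeal.isMaximal T)
  obtain ⟨j, hj, hjQ⟩ := SetLike.not_le_iff_exists.mp hlt
  obtain ⟨a, ha, haQ, c, hc⟩ := hA.exists_dvd_sub 0 j hjQ
  refine ⟨⟨a, ha⟩, ?_, haQ⟩
  rw [sub_zero] at hc
  rw [← hA.comap_maximalIdeal]
  exact Ideal.mem_comap.2 (hc ▸ Ideal.mul_mem_right c _ hj :)

theorem map_maximalIdeal (hA : IsFiberSubring Q x A) (hQ : ¬ Q.IsMaximal) :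
    (maximalIdeal A).map A.subtype = maximalIdeal T := by
  refine le_antisymm (Ideal.map_le_iff_le_comap.2 hA.comap_maximalIdeal.ge) fun t ht ↦ ?_
  obtain ⟨h, hh, hhQ⟩ := hA.exists_mem_maximalIdeal hQ
  obtain ⟨a, ha, -, c, hc⟩ := hA.exists_dvd_sub t h hhQ
  have hhT : (h : T) ∈ maximalIdeal T := hA.comap_maximalIdeal.ge hh
  have haA : (⟨a, ha⟩ : A) ∈ maximalIdeal A := by
    rw [← hA.comap_maximalIdeal]
    exact Ideal.mem_comap.2
      (sub_eq_iff_eq_add.1 hc ▸ add_mem (Ideal.mul_mem_right c _ hhT) ht :)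
  rw [show t = a - h * c by rw [← hc]; ring]
  exact sub_mem (Ideal.mem_map_of_mem A.subtype haA)
    (Ideal.mul_mem_right _ _ (Ideal.mem_map_of_mem A.subtype hh))

theorem comap_maximalIdeal_pow (hA : IsFiberSubring Q x A) (hQ : ¬ Q.IsMaximal) (n : ℕ) :
    (maximalIdeal T ^ n).comap A.subtype = maximalIdeal A ^ n := by
  obtain ⟨h, hh, hhQ⟩ := hA.exists_mem_maximalIdeal hQ
  rw [← hA.map_maximalIdeal hQ, ← Ideal.map_pow]
  exact hA.comap_map_eq (Ideal.pow_mem_pow hh n)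
    (by simpa using fun hn ↦ hhQ (Ideal.IsPrime.mem_of_pow_mem ‹_› n hn))

theorem quotientMap_bijective (hA : IsFiberSubring Q x A) (hQ : ¬ Q.IsMaximal) (n : ℕ) :
    Function.Bijective (Ideal.quotientMap (maximalIdeal T ^ n) A.subtype
      (hA.comap_maximalIdeal_pow hQ n).ge) := by
  obtain ⟨h, hh, hhQ⟩ := hA.exists_mem_maximalIdeal hQ
  refine ⟨Ideal.quotientMap_injective' (hA.comap_maximalIdeal_pow hQ n).le, fun t ↦ ?_⟩
  have hhT : (h : T) ^ n ∈ maximalIdeal T ^ n :=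
    Ideal.pow_mem_pow (Ideal.mem_comap.1 (hA.comap_maximalIdeal.ge hh)) n
  obtain ⟨a, rfl⟩ := hA.quotient_mk_comp_surjective hhT
    (fun hn ↦ hhQ (Ideal.IsPrime.mem_of_pow_mem ‹_› n hn)) t
  exact ⟨Ideal.Quotient.mk _ a, Ideal.quotientMap_mk⟩

/-- The inclusion of a fiber subring into a complete local ring induces an isomorphism on adic
completions. -/
theorem exists_ringEquiv (hA : IsFiberSubring Q x A) (hQ : ¬ Q.IsMaximal)
    [IsAdicComplete (maximalIdeal T) T] :
    ∃ φ : AdicCompletion (maximalIdeal A) A ≃+* T,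
      ∀ a : A, φ (algebraMap A (AdicCompletion (maximalIdeal A) A) a) = a := by
  let q (n : ℕ) := Ideal.quotientMap (maximalIdeal T ^ n) A.subtype
      (hA.comap_maximalIdeal_pow hQ n).ge
  let f (n : ℕ) : AdicCompletion (maximalIdeal A) A →+* T ⧸ maximalIdeal T ^ n :=
    (q n).comp (AdicCompletion.evalₐ (maximalIdeal A) n : _ →+* _)
  have hf : ∀ {m n : ℕ} (hle : m ≤ n),
      (Ideal.Quotient.factorPow (maximalIdeal T) hle).comp (f n) = f m := by
    intro m n hle
    refine RingHom.ext fun y ↦ ?_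
    induction y using AdicCompletion.induction_on with | _ y
    simp only [f, q, RingHom.comp_apply, RingHom.coe_coe, AdicCompletion.evalₐ_mk]
    exact congrArg (q m) (AdicCompletion.Ideal.mk_eq_mk _ hle y)
  let φ := IsAdicComplete.liftRingHom (maximalIdeal T) f hf
  have hφ (n : ℕ) (y) : Ideal.Quotient.mk (maximalIdeal T ^ n) (φ y) = f n y :=
    IsAdicComplete.mk_liftRingHom _ f hf n y
  have hinj : Function.Injective φ := by
    rw [injective_iff_map_eq_zero]
    intro y hy
    refine AdicCompletion.ext_evalₐ fun n ↦ (hA.quotientMap_bijective hQ n).1 ?_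
    rw [map_zero, map_zero]
    exact (hφ n y).symm.trans (by rw [hy, map_zero])
  have hsurj : Function.Surjective φ := by
    intro t
    choose a ha using fun n ↦ (hA.quotientMap_bijective hQ n).2 (Ideal.Quotient.mk _ t)
    choose b hb using fun n ↦ Ideal.Quotient.mk_surjective (a n)
    have hbt (n : ℕ) : (b n : T) - t ∈ maximalIdeal T ^ n := by
      have := ha n
      rw [← hb n, Ideal.quotientMap_mk] at this
      exact Ideal.Quotient.eq.1 this
    have hc (n : ℕ) : b n - b (n + 1) ∈ maximalIdeal A ^ n := by
      rw [← hA.comap_maximalIdeal_pow hQ n, Ideal.mem_comap, map_sub]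
      simpa using sub_mem (hbt n) (Ideal.pow_le_pow_right n.le_succ (hbt (n + 1)))
    let s : AdicCompletion.AdicCauchySequence (maximalIdeal A) A := .mk _ _ b fun n ↦ by
      rw [SModEq.sub_mem]
      simpa using hc n
    refine ⟨AdicCompletion.mk _ _ s, ?_⟩
    refine (IsHausdorff.eq_iff_smodEq (I := maximalIdeal T)).2 fun n ↦ ?_
    rw [SModEq.sub_mem, smul_eq_mul, Ideal.mul_top, ← Ideal.Quotient.eq, hφ n]
    simp only [f, q, RingHom.comp_apply, RingHom.coe_coe, AdicCompletion.evalₐ_mk,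
      Ideal.quotientMap_mk]
    exact Ideal.Quotient.eq.2 (hbt n)
  refine ⟨RingEquiv.ofBijective φ ⟨hinj, hsurj⟩, fun a ↦ ?_⟩
  refine (IsHausdorff.eq_iff_smodEq (I := maximalIdeal T)).2 fun n ↦ ?_
  rw [SModEq.sub_mem, smul_eq_mul, Ideal.mul_top, ← Ideal.Quotient.eq]
  refine (hφ n _).trans ?_
  simp [f, q]

end IsFiberSubring

open Cardinal in
/-- From each member of a family of at most `κ` subsets of cardinality at least `κ`, with `κ`
uncountable, one can choose an element so that the choices are algebraically independent. -/
theorem exists_algebraicIndependent_of_le_mk {D ι : Type} [CommRing D] [IsDomain D] [CharZero D]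
    {κ : Cardinal.{0}} (hκ : ℵ₀ < κ) (hι : #ι ≤ κ) (S : ι → Set D) (hS : ∀ i, κ ≤ #(S i)) :
    ∃ v : ι → D, (∀ i, v i ∈ S i) ∧ AlgebraicIndependent ℤ v := by
  classical
  obtain ⟨e⟩ : Nonempty (ι ≃ (#ι).ord.ToType) := Cardinal.eq.1 (mk_ord_toType _).symm
  have hlt (i : (#ι).ord.ToType) : #(Set.Iio i) < κ := by
    refine lt_of_lt_of_le (mk_Iio_lt i ?_) ((mk_ord_toType _).trans_le hι)
    simp
  have step (i : (#ι).ord.ToType) (f : ∀ j, j < i → D) : ∃ d ∈ S (e.symm i),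
      Transcendental (Algebra.adjoin ℤ (Set.range fun j : Set.Iio i ↦ f j j.2)) d := by
    by_contra! h
    refine (hS (e.symm i)).not_gt ?_
    set R := Algebra.adjoin ℤ (Set.range fun j : Set.Iio i ↦ f j j.2)
    have hsub : S (e.symm i) ⊆ {d | IsAlgebraic R d} := fun d hd ↦ not_not.1 (h d hd)
    have hR : #R < κ := by
      refine (Algebra.cardinalMk_adjoin_le ℤ _).trans_lt (max_lt (max_lt ?_ ?_) hκ)
      · exact mk_le_aleph0.trans_lt hκ
      · exact mk_range_le.trans_lt (hlt i)
    exact (mk_le_mk_of_subset hsub).trans_lt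
      ((Algebraic.cardinalMk_le_max R D).trans_lt (max_lt hR hκ))
  choose F hFS hFT using step
  let u : (#ι).ord.ToType → D := wellFounded_lt.fix F
  have hu (i) : u i = F i fun j _ ↦ u j := wellFounded_lt.fix_eq F i
  have huT (i) : Transcendental (Algebra.adjoin ℤ (u '' Set.Iio i)) (u i) := by
    have := hFT i fun j _ ↦ u j
    rwa [← hu, ← Set.image_eq_range] at this
  have hind : AlgebraicIndependent ℤ u := by
    refine algebraicIndependent_of_finite_type fun t ht ↦ ?_
    lift t to Finset (#ι).ord.ToType using ht
    induction t using Finset.induction_on_max with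
    | empty =>
      rw [Finset.coe_empty]
      exact algebraicIndependent_empty_type_iff.2 (algebraMap ℤ D).injective_int
    | insert a s has ih =>
      rw [Finset.coe_insert]
      refine AlgebraicIndepOn.insert ih fun h ↦ huT a ?_
      refine IsAlgebraic.adjoin_of_forall_isAlgebraic (s := u '' s) (fun y hy ↦ ?_) h
      exact absurd (Set.image_mono (fun j hj ↦ has j hj) hy.1) hy.2
  refine ⟨u ∘ e, fun i ↦ ?_, hind.comp e e.injective⟩
  rw [Function.comp_apply, hu]
  simpa using hFS (e i) fun j _ ↦ u j

theorem exists_add_mul_of_mem_adjoin_insert {R T : Type*} [CommRing R] [CommRing T] [Algebra R T]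
    {x : T} {s : Set T} {r : T} (hr : r ∈ Algebra.adjoin R (insert x s)) :
    ∃ a ∈ Algebra.adjoin R s, ∃ b ∈ Algebra.adjoin R (insert x s), r = a + x * b := by
  have hle : Algebra.adjoin R s ≤ Algebra.adjoin R (insert x s) :=
    Algebra.adjoin_mono (Set.subset_insert x s)
  have hx : x ∈ Algebra.adjoin R (insert x s) := Algebra.subset_adjoin (Set.mem_insert x s)
  induction hr using Algebra.adjoin_induction with
  | mem y hy =>
    obtain rfl | hy := hy
    · exact ⟨0, zero_mem _, 1, one_mem _, by simp⟩
    · exact ⟨y, Algebra.subset_adjoin hy, 0, zero_mem _, by simp⟩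
  | algebraMap r => exact ⟨_, algebraMap_mem _ r, 0, zero_mem _, by simp⟩
  | add y z _ _ hy hz =>
    obtain ⟨a, ha, b, hb, rfl⟩ := hy
    obtain ⟨a', ha', b', hb', rfl⟩ := hz
    exact ⟨a + a', add_mem ha ha', b + b', add_mem hb hb', by ring⟩
  | mul y z _ _ hy hz =>
    obtain ⟨a, ha, b, hb, rfl⟩ := hy
    obtain ⟨a', ha', b', hb', rfl⟩ := hz
    refine ⟨a * a', mul_mem ha ha', a * b' + b * a' + x * (b * b'), ?_, by ring⟩
    exact add_mem (add_mem (mul_mem (hle ha) hb') (mul_mem hb (hle ha')))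
      (mul_mem hx (mul_mem hb hb'))

/-- The elements of `T` that are fractions of elements of the subring `R` with denominators
outside the prime ideal `Q`. -/
def Subring.fractions {T : Type*} [CommRing T] (R : Subring T) (Q : Ideal T) [hQ : Q.IsPrime] :
    Subring T where
  carrier := {t | ∃ h ∈ R, h ∉ Q ∧ h * t ∈ R}
  mul_mem' := by
    rintro s t ⟨h, hh, hhQ, hs⟩ ⟨k, hk, hkQ, ht⟩
    exact ⟨h * k, mul_mem hh hk, hQ.mul_notMem hhQ hkQ,
      (by ring : h * k * (s * t) = h * s * (k * t)) ▸ mul_mem hs ht⟩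
  one_mem' := ⟨1, one_mem R, (Ideal.ne_top_iff_one Q).1 hQ.ne_top, by simp⟩
  add_mem' := by
    rintro s t ⟨h, hh, hhQ, hs⟩ ⟨k, hk, hkQ, ht⟩
    exact ⟨h * k, mul_mem hh hk, hQ.mul_notMem hhQ hkQ,
      (by ring : h * k * (s + t) = k * (h * s) + h * (k * t)) ▸
        add_mem (mul_mem hk hs) (mul_mem hh ht)⟩
  zero_mem' := ⟨1, one_mem R, (Ideal.ne_top_iff_one Q).1 hQ.ne_top, by simp⟩
  neg_mem' := by
    rintro t ⟨h, hh, hhQ, ht⟩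
    exact ⟨h, hh, hhQ, (mul_neg h t).symm ▸ neg_mem ht⟩

theorem isFiberSubring_fractions {T : Type*} [CommRing T] [IsDomain T] {Q : Ideal T}
    [hQ : Q.IsPrime] {x : T} (hx0 : x ≠ 0)
    (hx : ∀ h ∉ Q, ∀ t, x ∣ h * t → x ∣ t) {R : Subring T} (hxR : x ∈ R)
    (hR : ∀ r ∈ R, r ∈ Q → ∃ s ∈ R, r = x * s)
    (hd : ∀ t h, h ∉ Q → ∃ a ∈ R, a ∉ Q ∧ h ∣ a - t) :
    IsFiberSubring Q x (R.fractions Q) := by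
  have hle : R ≤ R.fractions Q := fun r hr ↦
    ⟨1, one_mem R, (Ideal.ne_top_iff_one Q).1 hQ.ne_top, by simpa using hr⟩
  refine ⟨hle hxR, ?_, ?_, fun t h hh ↦ ?_⟩
  · rintro a ⟨h, hh, hhQ, ha⟩ haQ
    obtain ⟨s, hs, has⟩ := hR _ ha (Q.mul_mem_left h haQ)
    obtain ⟨b, rfl⟩ := hx h hhQ a ⟨s, has⟩
    refine ⟨b, ⟨h, hh, hhQ, ?_⟩, rfl⟩
    rwa [mul_left_cancel₀ hx0 (by rw [← has]; ring : x * (h * b) = x * s)]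
  · rintro t h ⟨k, hk, hkQ, hkh⟩ hhQ ⟨l, hl, hlQ, hlt⟩
    refine ⟨l * (k * h), mul_mem hl hkh, hQ.mul_notMem hlQ (hQ.mul_notMem hkQ hhQ), ?_⟩
    rw [(by ring : l * (k * h) * t = k * (l * (h * t)))]
    exact mul_mem hk hlt
  · obtain ⟨a, ha, haQ, hda⟩ := hd t h hh
    exact ⟨a, hle ha, haQ, hda⟩

open Cardinal in
theorem exists_isFiberSubring {T : Type} [CommRing T] [IsDomain T] {Q : Ideal T} [hQ : Q.IsPrime]
    [CharZero (T ⧸ Q)] {x : T} (hxQ : x ∈ Q) (hx0 : x ≠ 0)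
    (hx : ∀ h ∉ Q, ∀ t, x ∣ h * t → x ∣ t) {κ : Cardinal.{0}} (hκ : ℵ₀ < κ) (hT : #T ≤ κ)
    (hTQ : κ ≤ #(T ⧸ Q)) : ∃ A : Subring T, IsFiberSubring Q x A := by
  obtain ⟨u, hu, hind⟩ := exists_algebraicIndependent_of_le_mk hκ (ι := T × {h // h ∉ Q})
    (by
      rw [mk_prod, lift_id, lift_id]
      exact mul_le_of_le hκ.le hT ((mk_subtype_le _).trans hT))
    (fun i ↦ Set.range fun d : T ⧸ Q ↦ Ideal.Quotient.mk Q i.1 + Ideal.Quotient.mk Q i.2 * d)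
    (fun i ↦ by
      rw [mk_range_eq]
      · exact hTQ
      · intro d e hde
        exact mul_left_cancel₀ (fun h ↦ i.2.2 (Ideal.Quotient.eq_zero_iff_mem.1 h))
          (add_left_cancel hde))
  have hv (i : T × {h // h ∉ Q}) : ∃ a, Ideal.Quotient.mk Q a = u i ∧ (i.2 : T) ∣ a - i.1 := by
    obtain ⟨d, hd⟩ := hu i
    obtain ⟨c, rfl⟩ := Ideal.Quotient.mk_surjective d
    exact ⟨i.1 + i.2 * c, by simpa using hd, c, by ring⟩
  choose v hvu hvd using hv
  let R := Algebra.adjoin ℤ (insert x (Set.range v))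
  have hvR (i) : v i ∈ R := Algebra.subset_adjoin (Set.mem_insert_of_mem _ ⟨i, rfl⟩)
  refine ⟨_, isFiberSubring_fractions hx0 hx (R := R.toSubring)
    (Algebra.subset_adjoin (Set.mem_insert _ _)) (fun r hr hrQ ↦ ?_) fun t h hh ↦
      ⟨v ⟨t, h, hh⟩, hvR _, fun hQv ↦ ?_, hvd ⟨t, h, hh⟩⟩⟩
  · obtain ⟨a, ha, b, hb, rfl⟩ := exists_add_mul_of_mem_adjoin_insert hr
    refine ⟨b, hb, ?_⟩
    rw [Algebra.adjoin_range_eq_range_aeval] at ha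
    obtain ⟨p, rfl⟩ := ha
    have hp : MvPolynomial.aeval u p = 0 := by
      have := Ideal.Quotient.eq_zero_iff_mem.2 ((Q.add_mem_iff_left (Q.mul_mem_right b hxQ)).1 hrQ)
      rw [← this, ← funext hvu]
      exact MvPolynomial.aeval_algebraMap_apply (T ⧸ Q) v p
    rw [hind.eq_zero_of_aeval_eq_zero p hp]
    simp
  · exact hind.ne_zero ⟨t, h, hh⟩ ((hvu _).symm.trans (Ideal.Quotient.eq_zero_iff_mem.2 hQv))

namespace MvPowerSeries

variable {σ R : Type*}

theorem exists_X_dvd_sub [Ring R] (i : σ) (f : MvPowerSeries σ R) :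
    ∃ r, X i ∣ f - r ∧ ∀ d, (d i = 0 → coeff d r = coeff d f) ∧ (d i ≠ 0 → coeff d r = 0) := by
  classical
  let r : MvPowerSeries σ R := fun d ↦ if d i = 0 then coeff d f else 0
  have hr (d) : coeff d r = if d i = 0 then coeff d f else 0 := rfl
  refine ⟨r, X_dvd_iff.2 fun d hd ↦ ?_, fun d ↦ ⟨fun hd ↦ ?_, fun hd ↦ ?_⟩⟩ <;> simp [hr, hd]

theorem mem_span_X_image_iff [CommRing R] {s : Finset σ} {f : MvPowerSeries σ R} :
    f ∈ Ideal.span (X '' (s : Set σ)) ↔ ∀ d : σ →₀ ℕ, (∀ i ∈ s, d i = 0) → coeff d f = 0 := by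
  classical
  constructor
  · intro hf d hd
    induction hf using Submodule.span_induction generalizing d with
    | mem g hg =>
      obtain ⟨i, hi, rfl⟩ := hg
      exact X_dvd_iff.1 dvd_rfl d (hd i hi)
    | zero => simp
    | add g h _ _ hg hh => rw [map_add, hg d hd, hh d hd, add_zero]
    | smul a g _ hg =>
      rw [smul_eq_mul, coeff_mul]
      refine Finset.sum_eq_zero fun p hp ↦ ?_
      rw [hg p.2 fun i hi ↦ ?_, mul_zero]
      have := DFunLike.congr_fun (Finset.HasAntidiagonal.mem_antidiagonal.1 hp) i
      rw [Finsupp.add_apply, hd i hi] at this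
      lia
  · induction s using Finset.induction_on generalizing f with
    | empty => exact fun hf ↦ (MvPowerSeries.ext (by simpa using hf) : f = 0) ▸ zero_mem _
    | insert i s _ ih =>
      intro hf
      obtain ⟨r, hfr, hr⟩ := exists_X_dvd_sub i f
      rw [← sub_add_cancel f r]
      refine add_mem (Ideal.mem_of_dvd _ hfr (Ideal.subset_span ⟨i, by simp⟩))
        (Ideal.span_mono (Set.image_mono (by simp)) (ih fun d hd ↦ ?_))
      by_cases hi : d i = 0
      · rw [(hr d).1 hi]
        exact hf d (by simpa [hi] using hd)
      · exact (hr d).2 hi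

theorem weightedOrder_indicator_eq_zero_iff [CommRing R] {s : Finset σ} {f : MvPowerSeries σ R} :
    f.weightedOrder (Set.indicator s 1) = 0 ↔ f ∉ Ideal.span (X '' (s : Set σ)) := by
  have hw (d : σ →₀ ℕ) : Finsupp.weight (Set.indicator (s : Set σ) (1 : σ → ℕ)) d = 0 ↔
      ∀ i ∈ s, d i = 0 := by
    rw [Finsupp.weight_apply, Finsupp.sum, Finset.sum_eq_zero_iff]
    refine forall_congr' fun i ↦ ?_
    by_cases hi : i ∈ s <;> simp [hi]
  rw [mem_span_X_image_iff, ← Nat.cast_zero, weightedOrder_eq_nat]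
  simp only [hw, not_lt_zero, false_imp_iff, implies_true, and_true]
  push Not
  exact exists_congr fun d ↦ and_comm

theorem isPrime_span_X_image [CommRing R] [IsDomain R] (s : Finset σ) :
    (Ideal.span (X '' (s : Set σ)) : Ideal (MvPowerSeries σ R)).IsPrime where
  ne_top' h := by
    have : (1 : MvPowerSeries σ R) ∈ Ideal.span (X '' (s : Set σ)) := h ▸ Submodule.mem_top
    simpa using mem_span_X_image_iff.1 this 0 (by simp)
  mem_or_mem' {f g} hfg := by
    by_contra! h
    refine weightedOrder_indicator_eq_zero_iff.1 ?_ hfg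
    rw [weightedOrder_mul, weightedOrder_indicator_eq_zero_iff.2 h.1,
      weightedOrder_indicator_eq_zero_iff.2 h.2, add_zero]

theorem prime_X [CommRing R] [IsDomain R] (i : σ) : Prime (X i : MvPowerSeries σ R) := by
  have : (X i : MvPowerSeries σ R) ≠ 0 := fun h ↦ by
    simpa [coeff_X] using congrArg (coeff (Finsupp.single i 1)) h
  rw [← Ideal.span_singleton_prime this]
  simpa using isPrime_span_X_image (R := R) {i}

theorem maximalIdeal_eq_span_range_X [Finite σ] {k : Type*} [Field k] :
    IsLocalRing.maximalIdeal (MvPowerSeries σ k) = Ideal.span (Set.range X) := by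
  cases nonempty_fintype σ
  ext f
  rw [← Set.image_univ, ← Finset.coe_univ, mem_span_X_image_iff, IsLocalRing.mem_maximalIdeal,
    mem_nonunits_iff, isUnit_iff_constantCoeff, isUnit_iff_ne_zero, not_not]
  constructor
  · intro hf d hd
    rw [show d = 0 from Finsupp.ext fun i ↦ hd i (Finset.mem_univ i)]
    exact hf
  · exact fun hf ↦ hf 0 (by simp)

end MvPowerSeries

open IsLocalRing in
theorem isAdicComplete_maximalIdeal_of_surjective {R S : Type*} [CommRing R] [IsLocalRing R]
    [CommRing S] [IsNoetherianRing S] [IsLocalRing S] [IsAdicComplete (maximalIdeal R) R]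
    [Algebra R S] (h : Function.Surjective (algebraMap R S)) :
    IsAdicComplete (maximalIdeal S) S := by
  have : IsHausdorff (maximalIdeal S) S := .of_isLocalRing _ _ (Ideal.IsPrime.ne_top inferInstance)
  have : IsPrecomplete (maximalIdeal S) S := by
    rw [← map_maximalIdeal_of_surjective _ h, IsPrecomplete.map_algebraMap_iff,
      ← AdicCompletion.of_surjective_iff]
    intro y
    obtain ⟨z, rfl⟩ := AdicCompletion.map_surjective (maximalIdeal R)
      (f := Algebra.linearMap R S) h y
    obtain ⟨r, rfl⟩ := AdicCompletion.of_surjective (maximalIdeal R) R z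
    exact ⟨_, (AdicCompletion.map_of _ _ r).symm⟩
  exact {}

section

open MvPowerSeries

/-- The images of `x, y, z, w` in `ℝ[[s, t, w]]`, namely `st, s², t², w`. -/
def toricImage : Fin 4 → MvPowerSeries (Fin 3) ℝ := ![X 0 * X 1, X 0 ^ 2, X 1 ^ 2, X 2]

theorem hasSubst_toricImage : HasSubst toricImage :=
  hasSubst_of_constantCoeff_zero fun i ↦ by fin_cases i <;> simp [toricImage]

/-- The continuous homomorphism from `ℝ[[x, y, z, w]]` to `ℝ[[s, t, w]]` with
`x ↦ st`, `y ↦ s²`, `z ↦ t²`, `w ↦ w`. -/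
def toricHom : PSex →+* MvPowerSeries (Fin 3) ℝ := (substAlgHom hasSubst_toricImage).toRingHom

theorem toricHom_X (i : Fin 4) : toricHom (X i) = toricImage i :=
  substAlgHom_X hasSubst_toricImage i

/-- The exponent of the image under `toricHom` of the monomial with exponent `d`. -/
def toricExponent (d : Fin 4 →₀ ℕ) : Fin 3 →₀ ℕ :=
  Finsupp.single 0 (d 0 + 2 * d 1) + Finsupp.single 1 (d 0 + 2 * d 2) + Finsupp.single 2 (d 3)

theorem prod_toricImage_pow (d : Fin 4 →₀ ℕ) :
    (d.prod fun i n ↦ toricImage i ^ n) = monomial (toricExponent d) 1 := by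
  rw [Finsupp.prod_fintype _ _ (by simp)]
  simp only [Fin.prod_univ_four, toricImage, Matrix.cons_val]
  have h : monomial (toricExponent d) (1 : ℝ) =
      X 0 ^ (d 0 + 2 * d 1) * X 1 ^ (d 0 + 2 * d 2) * X 2 ^ d 3 := by
    simp only [X_pow_eq, monomial_mul_monomial, mul_one, toricExponent]
  rw [h]
  ring

theorem coeff_toricHom {d : Fin 4 →₀ ℕ} (h0 : d 0 = 0) (h : d 1 = 0 ∨ d 2 = 0) (f : PSex) :
    coeff (toricExponent d) (toricHom f) = coeff d f := by
  have : toricHom f = subst toricImage f :=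
    congrFun (coe_substAlgHom hasSubst_toricImage) f
  rw [this, coeff_subst hasSubst_toricImage, finsum_eq_single _ d]
  · rw [prod_toricImage_pow, coeff_monomial_same, smul_eq_mul, mul_one]
  · intro e he
    rw [prod_toricImage_pow, coeff_monomial_ne, smul_zero]
    intro hde
    refine he (Finsupp.ext fun i ↦ ?_)
    have h1 := DFunLike.congr_fun hde 0
    have h2 := DFunLike.congr_fun hde 1
    have h3 := DFunLike.congr_fun hde 2
    simp [toricExponent] at h1 h2 h3
    fin_cases i <;> simp <;> lia

theorem relIex_le_ker_toricHom : relIex ≤ RingHom.ker toricHom := by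
  rw [relIex, Ideal.span_singleton_le_iff_mem, RingHom.mem_ker, map_sub, map_pow, map_mul,
    toricHom_X, toricHom_X, toricHom_X]
  simp only [toricImage, Matrix.cons_val]
  ring

/-- The homomorphism from `T` to `ℝ[[s, t, w]]` induced by `toricHom`. -/
def toricLift : Tex →+* MvPowerSeries (Fin 3) ℝ :=
  Ideal.Quotient.lift relIex toricHom relIex_le_ker_toricHom

theorem toricLift_mk (f : PSex) : toricLift (Ideal.Quotient.mk relIex f) = toricHom f := rfl

theorem toricLift_xbar : toricLift xbar = X 0 * X 1 := toricHom_X 0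

theorem xbar_ne_zero : xbar ≠ 0 := fun h ↦ by
  have := congrArg toricLift h
  rw [toricLift_xbar, map_zero] at this
  exact mul_ne_zero (prime_X 0).ne_zero (prime_X 1).ne_zero this

instance : Nontrivial Tex := ⟨xbar, 0, xbar_ne_zero⟩

theorem mk_X_one_mul_mk_X_two :
    Ideal.Quotient.mk relIex (X 1 * X 2) = xbar ^ 2 :=
  Eq.symm (Ideal.Quotient.eq.2 (Ideal.mem_span_singleton_self _))

theorem xbar_dvd_iff {t : Tex} :
    xbar ∣ t ↔ X 0 ∣ toricLift t ∧ X 1 ∣ toricLift t := by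
  constructor
  · rintro ⟨t, rfl⟩
    rw [map_mul, toricLift_xbar]
    exact ⟨⟨X 1 * _, mul_assoc _ _ _⟩, ⟨X 0 * toricLift t, by ring⟩⟩
  · rintro ⟨h0, h1⟩
    obtain ⟨f, rfl⟩ := Ideal.Quotient.mk_surjective t
    rw [toricLift_mk, X_dvd_iff] at h0 h1
    have hf (d : Fin 4 →₀ ℕ) (hd0 : d 0 = 0) (hd : d 1 = 0 ∨ d 2 = 0) : coeff d f = 0 := by
      rw [← coeff_toricHom hd0 hd]
      obtain hd | hd := hd
      · exact h0 _ (by simp [toricExponent, hd0, hd])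
      · exact h1 _ (by simp [toricExponent, hd0, hd])
    obtain ⟨r, hfr, hr⟩ := exists_X_dvd_sub 0 f
    have hr' (d : Fin 4 →₀ ℕ) (hd : d 1 = 0 ∨ d 2 = 0) : coeff d r = 0 := by
      by_cases hd0 : d 0 = 0
      · rw [(hr d).1 hd0, hf d hd0 hd]
      · exact (hr d).2 hd0
    obtain ⟨g, rfl⟩ := X_dvd_iff.2 fun d hd ↦ hr' d (.inl hd)
    obtain ⟨k, rfl⟩ := ((prime_X 2).dvd_or_dvd
      (X_dvd_iff.2 fun d hd ↦ hr' d (.inr hd))).resolve_left fun h ↦ by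
        simpa using X_dvd_iff.1 h (Finsupp.single 1 1) (by simp)
    rw [← sub_add_cancel f (X 1 * (X 2 * k)), map_add, ← mul_assoc, map_mul,
      mk_X_one_mul_mk_X_two]
    rw [← mul_assoc] at hfr
    exact dvd_add (map_dvd (Ideal.Quotient.mk relIex) hfr)
      ⟨xbar * Ideal.Quotient.mk relIex k, by ring⟩

instance : IsLocalRing Tex :=
  .of_surjective' (Ideal.Quotient.mk relIex) Ideal.Quotient.mk_surjective

instance : IsAdicComplete (IsLocalRing.maximalIdeal Tex) Tex := by
  have : IsAdicComplete (IsLocalRing.maximalIdeal PSex) PSex := by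
    rw [maximalIdeal_eq_span_range_X]
    infer_instance
  exact isAdicComplete_maximalIdeal_of_surjective (R := PSex) Ideal.Quotient.mk_surjective

theorem span_eq_span_image :
    Ideal.span {(X 0 : PSex), X 1, X 2} =
      Ideal.span (X '' (({0, 1, 2} : Finset (Fin 4)) : Set _)) := by
  simp [Set.image_insert_eq]

theorem relIex_le : relIex ≤ Ideal.span {(X 0 : PSex), X 1, X 2} := by
  rw [relIex, Ideal.span_singleton_le_iff_mem]
  refine sub_mem (Ideal.pow_mem_of_mem _ ?_ _ two_pos) (Ideal.mul_mem_right _ _ ?_) <;>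
    exact Ideal.subset_span (by simp)

theorem mk_mem_Qex_iff {f : PSex} :
    Ideal.Quotient.mk relIex f ∈ Qex ↔ f ∈ Ideal.span {(X 0 : PSex), X 1, X 2} := by
  rw [Qex, ← Ideal.mem_comap, Ideal.comap_map_of_surjective' _ Ideal.Quotient.mk_surjective,
    Ideal.mk_ker, sup_eq_left.2 relIex_le]

instance isPrime_Qex : Qex.IsPrime := by
  have : (Ideal.span {(X 0 : PSex), X 1, X 2}).IsPrime := by
    rw [span_eq_span_image]
    exact isPrime_span_X_image _
  exact Ideal.map_isPrime_of_surjective Ideal.Quotient.mk_surjective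
    (by rw [Ideal.mk_ker]; exact relIex_le)

theorem not_isMaximal_Qex : ¬ Qex.IsMaximal := fun h ↦ by
  have hw : Ideal.Quotient.mk relIex (X 3) ∈ Qex := by
    rw [IsLocalRing.eq_maximalIdeal h,
      ← IsLocalRing.map_maximalIdeal_of_surjective _ Ideal.Quotient.mk_surjective]
    refine Ideal.mem_map_of_mem _ ?_
    rw [maximalIdeal_eq_span_range_X]
    exact Ideal.subset_span ⟨3, rfl⟩
  rw [mk_mem_Qex_iff, span_eq_span_image, mem_span_X_image_iff] at hw
  simpa [coeff_X] using hw (Finsupp.single 3 1) (by simp)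

theorem xbar_mem_Qex : xbar ∈ Qex := mk_mem_Qex_iff.2 (Ideal.subset_span (by simp))

theorem toricLift_injective : Function.Injective toricLift := by
  rw [RingHom.injective_iff_ker_eq_bot]
  refine Submodule.eq_bot_of_le_smul_of_le_jacobson_bot (Ideal.span {xbar}) _
    ((isNoetherianRing_iff_ideal_fg _).1 inferInstance _) (fun t ht ↦ ?_) ?_
  · rw [RingHom.mem_ker] at ht
    obtain ⟨s, rfl⟩ := xbar_dvd_iff.2 ⟨ht ▸ dvd_zero _, ht ▸ dvd_zero _⟩
    refine Submodule.smul_mem_smul (Ideal.mem_span_singleton_self _) ?_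
    rw [map_mul, toricLift_xbar] at ht
    exact (mul_eq_zero.1 ht).resolve_left (mul_ne_zero (prime_X 0).ne_zero (prime_X 1).ne_zero)
  · rw [IsLocalRing.jacobson_eq_maximalIdeal _ bot_ne_top, Ideal.span_singleton_le_iff_mem]
    exact IsLocalRing.le_maximalIdeal isPrime_Qex.ne_top xbar_mem_Qex

instance isDomain_Tex : IsDomain Tex :=
  have : IsDomain (MvPowerSeries (Fin 3) ℝ) := NoZeroDivisors.to_isDomain _
  toricLift_injective.isDomain

theorem mem_Qex_of_dvd_toricLift {h : Tex} {i : Fin 3} (hi : i ≠ 2) (hd : X i ∣ toricLift h) :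
    h ∈ Qex := by
  obtain ⟨f, rfl⟩ := Ideal.Quotient.mk_surjective h
  rw [mk_mem_Qex_iff, span_eq_span_image, mem_span_X_image_iff]
  intro d hd'
  rw [← coeff_toricHom (hd' 0 (by simp)) (.inl (hd' 1 (by simp)))]
  refine X_dvd_iff.1 hd _ ?_
  fin_cases i <;> simp_all [toricExponent]

theorem xbar_dvd_of_dvd_mul {h : Tex} (hh : h ∉ Qex) {t : Tex} (hd : xbar ∣ h * t) : xbar ∣ t := by
  rw [xbar_dvd_iff, map_mul] at hd
  rw [xbar_dvd_iff]
  exact ⟨((prime_X 0).dvd_or_dvd hd.1).resolve_left fun h0 ↦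
      hh (mem_Qex_of_dvd_toricLift (by decide) h0),
    ((prime_X 1).dvd_or_dvd hd.2).resolve_left fun h1 ↦
      hh (mem_Qex_of_dvd_toricLift (by decide) h1)⟩

end

theorem exists_smul_eq_zero_of_mem_associatedPrimes {R M : Type*} [CommRing R] [AddCommGroup M]
    [Module R M] {P : Ideal R} (hP : P ∈ associatedPrimes R M) :
    ∃ m : M, m ≠ 0 ∧ ∀ a ∈ P, ∃ n : ℕ, a ^ n • m = 0 := by
  obtain ⟨m, hm⟩ := hP.eq_radical_colon
  refine ⟨m, ?_, fun a ha ↦ ?_⟩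
  · rintro rfl
    refine hP.ne_top ?_
    rw [hm]
    simp
  · rw [hm] at ha
    obtain ⟨n, hn⟩ := ha
    exact ⟨n, by simpa [Submodule.mem_colon_singleton] using hn⟩

theorem eq_zero_or_eq_pow_mul_of_mem_closure {T : Type*} [CommRing T] [IsLocalRing T] {x : T}
    (hx : x ∈ IsLocalRing.maximalIdeal T) (hT : ∀ n : ℤ, n ≠ 0 → IsUnit (n : T)) {y : T}
    (hy : y ∈ Subring.closure {x}) : y = 0 ∨ ∃ (n : ℕ) (u : T), IsUnit u ∧ y = x ^ n * u := by
  have hy' : y ∈ Algebra.adjoin ℤ {x} := by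
    rw [Algebra.adjoin_int]
    exact hy
  rw [Algebra.adjoin_singleton_eq_range_aeval] at hy'
  obtain ⟨p, rfl⟩ := hy'
  by_cases hp : p = 0
  · simp [hp]
  obtain ⟨q, hpq, hq⟩ := Polynomial.exists_eq_pow_rootMultiplicity_mul_and_not_dvd p hp 0
  rw [map_zero, sub_zero, Polynomial.X_dvd_iff] at hq
  refine .inr ⟨p.rootMultiplicity 0, Polynomial.aeval x q, ?_, ?_⟩
  swap
  · conv_lhs => rw [hpq]
    simp
  by_contra hu
  have hc : (q.coeff 0 : T) ∈ IsLocalRing.maximalIdeal T := by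
    have h := congrArg (Polynomial.aeval x) q.X_mul_divX_add
    simp only [map_add, map_mul, Polynomial.aeval_X, eq_intCast, map_intCast] at h
    rw [← sub_eq_iff_eq_add'.2 h.symm]
    exact sub_mem hu (Ideal.mul_mem_right _ _ hx)
  exact hc (hT _ hq)

open Cardinal in
theorem mk_Tex_le : #Tex ≤ 𝔠 := by
  refine mk_quotient_le.trans ?_
  change #((Fin 4 →₀ ℕ) → ℝ) ≤ 𝔠
  simp [mk_real]

theorem isUnit_intCast_Tex (n : ℤ) (hn : n ≠ 0) : IsUnit (n : Tex) := by
  have : IsUnit (n : ℝ) := (Int.cast_ne_zero.2 hn).isUnit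
  simpa using this.map (algebraMap ℝ Tex)

open Cardinal in
theorem exists_isFiberSubring_Tex : ∃ A : Subring Tex, IsFiberSubring Qex xbar A :=
  have hinj := (algebraMap ℝ (Tex ⧸ Qex)).injective
  have : CharZero (Tex ⧸ Qex) := charZero_of_injective_algebraMap hinj
  exists_isFiberSubring xbar_mem_Qex xbar_ne_zero (fun _ hh _ ↦ xbar_dvd_of_dvd_mul hh)
    aleph0_lt_continuum mk_Tex_le (mk_real ▸ mk_le_of_injective hinj)

/-- **Example.** `T = ℝ[[x,y,z,w]]/(x²-yz)` is a complete local Noetherian domain, the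
image `Q` of `(x,y,z)` is a nonmaximal prime, `x` is a nonzero element of `Q`, the
conditions of the main theorem hold, and consequently there is a local domain `A ⊆ T`
containing `x` with `Â = T`, `xA` prime, `Q ∩ A = xA`, and every prime `Q'` of `T` lying
over `xA` is contained in `Q` (the formal fiber of `xA` is local with maximal ideal `Q`). -/
theorem statement13 :
    IsDomain Tex ∧ IsNoetherianRing Tex ∧ IsLocalRing Tex ∧
    Qex.IsPrime ∧ ¬ Qex.IsMaximal ∧
    xbar ∈ Qex ∧ xbar ≠ 0 ∧
    (∀ P ∈ associatedPrimes Tex (Tex ⧸ Ideal.span {xbar}), P ≤ Qex) ∧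
    (∀ t ∈ CompAvoid Qex xbar ((Subring.closure {xbar} : Subring Tex) : Set Tex),
      t ∈ Subring.closure ({xbar} : Set Tex) → t = 0) ∧
    (∀ P ∈ associatedPrimes Tex Tex, ∀ y ∈ Subring.closure ({xbar} : Set Tex),
      y ∈ P → y = 0) ∧
    ∃ A : Subring Tex, ∃ hx : xbar ∈ A,
      IsNoetherianRing ↥A ∧ IsDomain ↥A ∧
      ∃ _ : IsLocalRing ↥A,
        (∃ φ : AdicCompletion (IsLocalRing.maximalIdeal ↥A) ↥A ≃+* Tex,
          ∀ a : ↥A,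
            φ (algebraMap ↥A (AdicCompletion (IsLocalRing.maximalIdeal ↥A) ↥A) a)
              = (a : Tex)) ∧
        (Ideal.span {(⟨xbar, hx⟩ : ↥A)}).IsPrime ∧
        Qex.comap A.subtype = Ideal.span {(⟨xbar, hx⟩ : ↥A)} ∧
        (∀ Q' : Ideal Tex, Q'.IsPrime →
          Q'.comap A.subtype = Ideal.span {(⟨xbar, hx⟩ : ↥A)} → Q' ≤ Qex) := by
  refine ⟨inferInstance, inferInstance, inferInstance, inferInstance, not_isMaximal_Qex,
    xbar_mem_Qex, xbar_ne_zero, fun P hP h hh ↦ ?_, ?_, fun P hP y _ hy ↦ ?_, ?_⟩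
  · obtain ⟨m, hm, hann⟩ := exists_smul_eq_zero_of_mem_associatedPrimes hP
    obtain ⟨n, hn⟩ := hann h hh
    obtain ⟨t, rfl⟩ := Ideal.Quotient.mk_surjective m
    by_contra hhQ
    refine hm (Ideal.Quotient.eq_zero_iff_dvd _ _ |>.2 (xbar_dvd_of_dvd_mul (h := h ^ n)
      (fun hQ ↦ hhQ (isPrime_Qex.mem_of_pow_mem n hQ)) ?_))
    rw [← Ideal.Quotient.eq_zero_iff_dvd]
    exact hn
  · rintro t ⟨q, hq, hqx, r, hr, rfl⟩ ht
    have hx := IsLocalRing.le_maximalIdeal isPrime_Qex.ne_top xbar_mem_Qex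
    rw [Ideal.mem_span_singleton] at hqx
    obtain h | ⟨m, u, hu, hmu⟩ := eq_zero_or_eq_pow_mul_of_mem_closure hx isUnit_intCast_Tex ht
    · exact h
    obtain rfl | ⟨k, v, hv, rfl⟩ := eq_zero_or_eq_pow_mul_of_mem_closure hx isUnit_intCast_Tex hr
    · exact mul_zero q
    exfalso
    obtain h | h := le_or_gt m k
    · obtain ⟨j, rfl⟩ := Nat.exists_eq_add_of_le h
      have : q * (xbar ^ j * v) = u := mul_left_cancel₀ (pow_ne_zero m xbar_ne_zero)
        (by rw [← hmu]; ring)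
      exact isPrime_Qex.ne_top (Qex.eq_top_of_isUnit_mem (this ▸ Qex.mul_mem_right _ hq) hu)
    · obtain ⟨j, rfl⟩ := Nat.exists_eq_add_of_lt h
      have : q * v = xbar * (xbar ^ j * u) := mul_left_cancel₀ (pow_ne_zero k xbar_ne_zero)
        (by linear_combination hmu)
      exact hqx ((hv.dvd_mul_right).1 ⟨_, this⟩)
  · obtain ⟨m, hm, hann⟩ := exists_smul_eq_zero_of_mem_associatedPrimes hP
    obtain ⟨n, hn⟩ := hann y hy
    exact eq_zero_of_pow_eq_zero ((mul_eq_zero.1 hn).resolve_right hm)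
  · obtain ⟨A, hA⟩ := exists_isFiberSubring_Tex
    have := hA.isLocalHom
    have : IsLocalRing A := RingHom.domain_isLocalRing A.subtype
    refine ⟨A, hA.mem, hA.isNoetherianRing xbar_mem_Qex, inferInstance, this,
      hA.exists_ringEquiv not_isMaximal_Qex, ?_, hA.comap_eq_span xbar_mem_Qex,
      fun _ _ ↦ hA.le_of_comap_eq xbar_mem_Qex⟩
    rw [← hA.comap_eq_span xbar_mem_Qex]
    infer_instance

end
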